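/- arXiv:1906.03761 — 2 statements merged into one kernel-verified Lean document; each statement's English description precedes it below -/
import Mathlib

section
/- Fix κ > 0, α ∈ ℝ, σ > 0, and let Z₁, Z₂ be independent standard normal random variables. Let ρ(t) = log(1 + e^t), with ρ'(t) = e^t/(1 + e^t), and for γ > 0 let M_ρ(v, γ) = min_{x∈ℝ}[ρ(x) + (x − v)²/(2γ)] be the Moreau envelope and Prox_{γρ}(v) its minimizer. Define F : (0, ∞) → ℝ by F(γ) = −γ/4 + E[ ρ'(κZ₁)·M_ρ(καZ₁ + σZ₂ + γ, γ) + ρ'(−κZ₁)·M_ρ(καZ₁ + σZ₂, γ) ]. Then F is differentiable on (0, ∞) with F'(γ) = −(1/γ²)·E[ ρ'(−κZ₁)·(καZ₁ + σZ₂ − Prox_{γρ}(καZ₁ + σZ₂))² ]. -/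
open MeasureTheory ProbabilityTheory

/-- The logistic link function ρ(t) = log(1 + eᵗ). -/
noncomputable def rho (t : ℝ) : ℝ := Real.log (1 + Real.exp t)

/-- The standard logistic function ρ'(t) = eᵗ/(1 + eᵗ). -/
noncomputable def rho' (t : ℝ) : ℝ := Real.exp t / (1 + Real.exp t)

/-- The joint law of two independent standard normals (Z₁, Z₂). -/
noncomputable def gauss2 : Measure (ℝ × ℝ) :=
  (gaussianReal 0 1).prod (gaussianReal 0 1)

theorem rho'_pos (t : ℝ) : 0 < rho' t := by
  unfold rho'; positivity

theorem rho'_add_rho'_neg (t : ℝ) : rho' t + rho' (-t) = 1 := by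
  unfold rho'
  rw [Real.exp_neg]
  have := Real.exp_pos t
  field_simp
  ring

theorem rho'_le_one (t : ℝ) : rho' t ≤ 1 := by
  linarith [rho'_add_rho'_neg t, rho'_pos (-t)]

theorem continuous_rho' : Continuous rho' := by
  unfold rho'
  exact Real.continuous_exp.div (by fun_prop) fun t => by positivity

theorem hasDerivAt_rho (t : ℝ) : HasDerivAt rho (rho' t) t :=
  ((Real.hasDerivAt_exp t).const_add 1).log (by positivity)

theorem continuous_rho : Continuous rho :=
  continuous_iff_continuousAt.2 fun t => (hasDerivAt_rho t).continuousAt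

theorem rho_nonneg (t : ℝ) : 0 ≤ rho t :=
  Real.log_nonneg (by linarith [Real.exp_pos t])

theorem rho_neg (t : ℝ) : rho (-t) = rho t - t := by
  unfold rho
  rw [eq_sub_iff_add_eq]
  nth_rewrite 2 [← Real.log_exp t]
  rw [← Real.log_mul (by positivity) (by positivity), add_mul, ← Real.exp_add]
  simp [add_comm]

theorem rho_le (t : ℝ) : rho t ≤ 1 + |t| := by
  have h : rho |t| ≤ 1 + |t| := by
    unfold rho
    rw [Real.log_le_iff_le_exp (by positivity), Real.exp_add]
    nlinarith [Real.add_one_le_exp (1 : ℝ), Real.one_le_exp (abs_nonneg t)]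
  refine le_trans ?_ h
  exact Real.log_le_log (by positivity) (by gcongr; exact le_abs_self t)

theorem rho'_mono : Monotone rho' := by
  intro a b hab
  unfold rho'
  rw [div_le_div_iff₀ (by positivity) (by positivity)]
  nlinarith [Real.exp_le_exp.2 hab]

/-- The first-order condition characterizing the proximal point of `rho`. -/
theorem add_mul_rho'_eq_of_isMinOn {γ v z : ℝ} (hγ : 0 < γ)
    (h : IsMinOn (fun x : ℝ => rho x + (x - v) ^ 2 / (2 * γ)) Set.univ z) :
    z + γ * rho' z = v := by
  have hd : HasDerivAt (fun x : ℝ => rho x + (x - v) ^ 2 / (2 * γ))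
      (rho' z + (2 * (z - v)) / (2 * γ)) z := by
    have := (((hasDerivAt_id z).sub_const v).pow 2).div_const (2 * γ)
    simp only [id, mul_one, Nat.cast_ofNat, Nat.add_one_sub_one, pow_one] at this
    exact (hasDerivAt_rho z).add this
  have h0 := (h.isLocalMin Filter.univ_mem).hasDerivAt_eq_zero hd
  field_simp at h0
  linarith

/-- Joint Lipschitz estimate for the solution of `z + γ * rho' z = v`. -/
theorem abs_sub_le_of_add_mul_rho'_eq {s t v w x y : ℝ} (hs : 0 < s)
    (hx : x + s * rho' x = v) (hy : y + t * rho' y = w) :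
    |x - y| ≤ |t - s| + |v - w| := by
  have hm : 0 ≤ (x - y) * (rho' x - rho' y) := by
    rcases le_total x y with h | h
    · exact mul_nonneg_of_nonpos_of_nonpos (by linarith) (by linarith [rho'_mono h])
    · exact mul_nonneg (by linarith) (by linarith [rho'_mono h])
  have he : (x - y) ^ 2 + s * ((x - y) * (rho' x - rho' y)) =
      (x - y) * ((t - s) * rho' y + (v - w)) := by
    rw [← hx, ← hy]; ring
  have h1 : |x - y| * |x - y| ≤ |x - y| * (|t - s| + |v - w|) := by
    calc |x - y| * |x - y| = (x - y) ^ 2 := by rw [abs_mul_abs_self, sq]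
      _ ≤ (x - y) * ((t - s) * rho' y + (v - w)) := by nlinarith [mul_nonneg hs.le hm]
      _ ≤ |x - y| * |(t - s) * rho' y + (v - w)| := by rw [← abs_mul]; exact le_abs_self _
      _ ≤ |x - y| * (|t - s| + |v - w|) := by
        gcongr
        refine (abs_add_le _ _).trans (add_le_add_left ?_ _)
        rw [abs_mul, abs_of_pos (rho'_pos y)]
        exact mul_le_of_le_one_right (abs_nonneg _) (rho'_le_one y)
  rcases (abs_nonneg (x - y)).eq_or_lt with h | h
  · rw [← h]; positivity
  · exact le_of_mul_le_mul_left h1 h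

/-- An envelope theorem: two-sided first-order bounds with a continuous slope give a derivative. -/
theorem hasDerivAt_of_envelope {f q g : ℝ → ℝ} {g' t : ℝ} (hg : HasDerivAt g g' t)
    (hq : ContinuousAt q t)
    (hupper : ∀ᶠ s in nhds t, f s - f t ≤ q t * (g s - g t))
    (hlower : ∀ᶠ s in nhds t, q s * (g s - g t) ≤ f s - f t) :
    HasDerivAt f (q t * g') t := by
  have h1 : (fun s => f s - f t - q t * (g s - g t)) =o[nhds t] fun s => s - t := by
    have hq0 : (fun s => q s - q t) =o[nhds t] fun _ => (1 : ℝ) := by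
      rw [Asymptotics.isLittleO_one_iff]
      simpa using hq.sub_const (q t)
    have hmul := hq0.mul_isBigO hg.isBigO_sub
    simp only [one_mul] at hmul
    refine Asymptotics.IsBigO.trans_isLittleO (Asymptotics.IsBigO.of_bound 1 ?_) hmul
    filter_upwards [hupper, hlower] with s hu hl
    rw [one_mul, Real.norm_eq_abs, Real.norm_eq_abs, abs_of_nonpos (by linarith)]
    refine le_trans ?_ (neg_le_abs _)
    linarith
  have h2 := (hasDerivAt_iff_isLittleO.1 (hg.const_mul (q t)))
  rw [hasDerivAt_iff_isLittleO]
  refine (h1.add h2).congr_left fun s => ?_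
  simp only [smul_eq_mul]
  ring

instance : IsProbabilityMeasure gauss2 := by
  unfold gauss2; infer_instance

theorem measurePreserving_neg_gauss2 :
    MeasurePreserving (fun p : ℝ × ℝ => -p) gauss2 gauss2 := by
  have h : MeasurePreserving (fun x : ℝ => -x) (gaussianReal 0 1) (gaussianReal 0 1) :=
    ⟨measurable_neg, by rw [gaussianReal_map_neg, neg_zero]⟩
  exact h.prod h

theorem integral_neg_gauss2 (f : ℝ × ℝ → ℝ) :
    ∫ p, f (-p) ∂gauss2 = ∫ p, f p ∂gauss2 :=
  measurePreserving_neg_gauss2.integral_comp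
    (MeasurableEquiv.neg (ℝ × ℝ)).measurableEmbedding f

theorem integrable_linear_gauss2 (a b : ℝ) :
    Integrable (fun p : ℝ × ℝ => a * p.1 + b * p.2) gauss2 := by
  have h : Integrable (fun x : ℝ => x) (gaussianReal 0 1) :=
    (memLp_id_gaussianReal 1).integrable (by simp)
  exact ((h.comp_fst _).const_mul a).add ((h.comp_snd _).const_mul b)

theorem integrable_rho'_mul {f : ℝ × ℝ → ℝ} (hf : Integrable f gauss2) (c : ℝ) :
    Integrable (fun p : ℝ × ℝ => rho' (c * p.1) * f p) gauss2 := by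
  refine hf.bdd_mul (c := 1) ?_ (Filter.Eventually.of_forall fun p => ?_)
  · exact (continuous_rho'.comp (by fun_prop)).aestronglyMeasurable
  · rw [Real.norm_eq_abs, abs_of_pos (rho'_pos _)]
    exact rho'_le_one _

theorem integral_rho'_gauss2 (c : ℝ) : ∫ p : ℝ × ℝ, rho' (c * p.1) ∂gauss2 = 1 / 2 := by
  have hi (c : ℝ) : Integrable (fun p : ℝ × ℝ => rho' (c * p.1)) gauss2 := by
    simpa using integrable_rho'_mul (integrable_const (1 : ℝ)) c
  have h1 := integral_neg_gauss2 fun p => rho' (c * p.1)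
  have h2 := integral_add (hi c) (hi (-c))
  simp only [neg_mul, rho'_add_rho'_neg] at h2
  simp only [Prod.fst_neg, mul_neg] at h1
  rw [h1] at h2
  simp at h2
  linarith

/-- Fix κ > 0, α ∈ ℝ, σ > 0.  Let P γ v = Prox_{γρ}(v) (minimizer of
x ↦ ρ(x) + (x−v)²/(2γ)) and M γ v = M_ρ(v, γ) the Moreau envelope, for γ > 0.
Define F(γ) = −γ/4 + E[ρ'(κZ₁)·M_ρ(καZ₁+σZ₂+γ, γ) + ρ'(−κZ₁)·M_ρ(καZ₁+σZ₂, γ)]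
for γ > 0.  Then F is differentiable on (0, ∞) with
F'(γ) = −(1/γ²)·E[ρ'(−κZ₁)·(καZ₁+σZ₂ − Prox_{γρ}(καZ₁+σZ₂))²]. -/
theorem stmt11 (κ α σ : ℝ) (hκ : 0 < κ) (hσ : 0 < σ)
    (P M : ℝ → ℝ → ℝ)
    (hP : ∀ γ : ℝ, 0 < γ → ∀ v : ℝ,
      IsMinOn (fun x : ℝ => rho x + (x - v) ^ 2 / (2 * γ)) Set.univ (P γ v))
    (hM : ∀ γ : ℝ, 0 < γ → ∀ v : ℝ,
      M γ v = rho (P γ v) + (P γ v - v) ^ 2 / (2 * γ))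
    (F : ℝ → ℝ)
    (hF : ∀ γ : ℝ, 0 < γ → F γ = -γ / 4 +
      ∫ p : ℝ × ℝ,
        (rho' (κ * p.1) * M γ (κ * α * p.1 + σ * p.2 + γ) +
          rho' (-(κ * p.1)) * M γ (κ * α * p.1 + σ * p.2)) ∂gauss2)
    (γ : ℝ) (hγ : 0 < γ) :
    HasDerivWithinAt F
      (-(1 / γ ^ 2) *
        ∫ p : ℝ × ℝ,
          rho' (-(κ * p.1)) *
            (κ * α * p.1 + σ * p.2 - P γ (κ * α * p.1 + σ * p.2)) ^ 2 ∂gauss2)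
      (Set.Ioi (0 : ℝ)) γ := by
  have hfoc : ∀ s : ℝ, 0 < s → ∀ v, P s v + s * rho' (P s v) = v := fun s hs v =>
    add_mul_rho'_eq_of_isMinOn hs (hP s hs v)
  have hMle : ∀ s : ℝ, 0 < s → ∀ v x, M s v ≤ rho x + (x - v) ^ 2 / (2 * s) :=
    fun s hs v x => by
      rw [hM s hs v]
      exact hP s hs v (Set.mem_univ x)
  have hMshift : ∀ s : ℝ, 0 < s → ∀ v, M s (v + s) = M s (-v) + v + s / 2 := by
    intro s hs v
    have key : ∀ x : ℝ, rho (-x) + (-x - (v + s)) ^ 2 / (2 * s) =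
        rho x + (x - -v) ^ 2 / (2 * s) + v + s / 2 := by
      intro x
      rw [rho_neg]
      field_simp
      ring
    have h1 := hMle s hs (v + s) (-P s (-v))
    have h2 := hMle s hs (-v) (-P s (v + s))
    have h3 := key (-P s (v + s))
    rw [neg_neg] at h3
    rw [key, ← hM s hs] at h1
    rw [← hM s hs] at h3
    linarith
  have hPcont : ∀ s : ℝ, 0 < s → Continuous (P s) := by
    intro s hs
    refine (LipschitzWith.of_dist_le_mul (K := 1) fun v w => ?_).continuous
    have := abs_sub_le_of_add_mul_rho'_eq hs (hfoc s hs v) (hfoc s hs w)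
    simpa [Real.dist_eq] using this
  have hPcont' : ∀ v s : ℝ, 0 < s → ContinuousAt (fun t => P t v) s := by
    intro v s hs
    refine continuousAt_of_locally_lipschitz hs 1 fun t ht => ?_
    have ht0 : 0 < t := by
      rw [Real.dist_eq] at ht
      linarith [(abs_lt.1 ht).1]
    have := abs_sub_le_of_add_mul_rho'_eq ht0 (hfoc t ht0 v) (hfoc s hs v)
    simpa [Real.dist_eq, abs_sub_comm] using this
  have hMcont : ∀ s : ℝ, 0 < s → Continuous (M s) := by
    intro s hs
    rw [funext (hM s hs)]
    have := hPcont s hs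
    exact (continuous_rho.comp this).add (by fun_prop)
  have hMabs : ∀ s : ℝ, 0 < s → ∀ v, |M s v| ≤ 1 + |v| := by
    intro s hs v
    have h0 : 0 ≤ M s v := by
      rw [hM s hs]
      have := rho_nonneg (P s v)
      positivity
    rw [abs_of_nonneg h0]
    have := hMle s hs v v
    simp only [sub_self, ne_eq, OfNat.ofNat_ne_zero, not_false_eq_true, zero_pow, zero_div,
      add_zero] at this
    linarith [rho_le v]
  have hMderiv : ∀ v s : ℝ, 0 < s →
      HasDerivAt (fun t => M t v) (-(v - P s v) ^ 2 / (2 * s ^ 2)) s := by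
    intro v s hs
    have hg : HasDerivAt (fun t : ℝ => t⁻¹) (-(s ^ 2)⁻¹) s := hasDerivAt_inv hs.ne'
    have hq : ContinuousAt (fun t => (P t v - v) ^ 2 / 2) s :=
      (((hPcont' v s hs).sub_const v).pow 2).div_const 2
    convert hasDerivAt_of_envelope (f := fun t => M t v) hg hq ?_ ?_ using 1
    · field_simp
      ring
    · filter_upwards [lt_mem_nhds hs] with t ht
      have := hMle t ht v (P s v)
      rw [hM s hs v]
      have e : (P s v - v) ^ 2 / 2 * (t⁻¹ - s⁻¹) =
        (P s v - v) ^ 2 / (2 * t) - (P s v - v) ^ 2 / (2 * s) := by field_simp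
      linarith
    · filter_upwards [lt_mem_nhds hs] with t ht
      have := hMle s hs v (P t v)
      rw [hM t ht v]
      have e : (P t v - v) ^ 2 / 2 * (t⁻¹ - s⁻¹) =
        (P t v - v) ^ 2 / (2 * t) - (P t v - v) ^ 2 / (2 * s) := by field_simp
      linarith
  set V : ℝ × ℝ → ℝ := fun p => κ * α * p.1 + σ * p.2 with hV
  have hVc : Continuous V := by fun_prop
  have hVi : Integrable V gauss2 := integrable_linear_gauss2 _ _
  have hMi : ∀ s : ℝ, 0 < s → Integrable (fun p => M s (V p)) gauss2 := by
    intro s hs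
    refine ((integrable_const (1 : ℝ)).add hVi.abs).mono'
      ((hMcont s hs).comp hVc).aestronglyMeasurable (Filter.Eventually.of_forall fun p => ?_)
    exact hMabs s hs (V p)
  have hMi' : ∀ s : ℝ, 0 < s → Integrable (fun p => M s (-V p)) gauss2 := by
    intro s hs
    refine ((integrable_const (1 : ℝ)).add hVi.abs).mono'
      ((hMcont s hs).comp hVc.neg).aestronglyMeasurable (Filter.Eventually.of_forall fun p => ?_)
    simpa using hMabs s hs (-V p)
  have hFeq : ∀ s : ℝ, 0 < s → F s = (∫ p, rho' (κ * p.1) * V p ∂gauss2) +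
      2 * ∫ p, rho' (-(κ * p.1)) * M s (V p) ∂gauss2 := by
    intro s hs
    have i1 := integrable_rho'_mul (hMi' s hs) κ
    have i2 := integrable_rho'_mul hVi κ
    have i3 := integrable_rho'_mul (integrable_const (s / 2)) κ
    have i4 := integrable_rho'_mul (hMi s hs) (-κ)
    simp only [neg_mul] at i4
    have i12 : Integrable
        (fun p => rho' (κ * p.1) * M s (-V p) + rho' (κ * p.1) * V p) gauss2 := i1.add i2
    have i123 : Integrable (fun p => rho' (κ * p.1) * M s (-V p) + rho' (κ * p.1) * V p +
        rho' (κ * p.1) * (s / 2)) gauss2 := i12.add i3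
    have hsym := integral_neg_gauss2 fun p => rho' (-(κ * p.1)) * M s (V p)
    have hVneg : ∀ p, V (-p) = -V p := fun p => by simp only [hV, Prod.fst_neg, Prod.snd_neg]; ring
    simp only [hVneg, Prod.fst_neg, mul_neg, neg_neg] at hsym
    have hsplit : ∀ p : ℝ × ℝ, rho' (κ * p.1) * M s (κ * α * p.1 + σ * p.2 + s) +
          rho' (-(κ * p.1)) * M s (κ * α * p.1 + σ * p.2) =
        rho' (κ * p.1) * M s (-V p) + rho' (κ * p.1) * V p + rho' (κ * p.1) * (s / 2) +
          rho' (-(κ * p.1)) * M s (V p) := by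
      intro p
      rw [hMshift s hs]
      simp only [hV]
      ring
    rw [hF s hs, integral_congr_ae (Filter.Eventually.of_forall hsplit),
      integral_add i123 i4, integral_add i12 i3, integral_add i1 i2, hsym,
      integral_mul_const, integral_rho'_gauss2]
    ring
  have hball : ∀ s ∈ Metric.ball γ γ, 0 < s := by
    intro s hs
    rw [Metric.mem_ball, Real.dist_eq] at hs
    linarith [(abs_lt.1 hs).1]
  have hw : Continuous fun p : ℝ × ℝ => rho' (-(κ * p.1)) := continuous_rho'.comp (by fun_prop)
  have hint := (hasDerivAt_integral_of_dominated_loc_of_deriv_le (μ := gauss2)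
    (F := fun s p => rho' (-(κ * p.1)) * M s (V p))
    (F' := fun s p => rho' (-(κ * p.1)) * (-(V p - P s (V p)) ^ 2 / (2 * s ^ 2)))
    (x₀ := γ) (bound := fun _ => 1 / 2) (Metric.ball_mem_nhds γ hγ)
    (by
      filter_upwards [lt_mem_nhds hγ] with s hs
      exact (hw.mul ((hMcont s hs).comp hVc)).aestronglyMeasurable)
    (by simpa using integrable_rho'_mul (hMi γ hγ) (-κ))
    (by
      have := hPcont γ hγ
      exact (hw.mul (by fun_prop)).aestronglyMeasurable)
    (Filter.Eventually.of_forall fun p s hs => by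
      have hs := hball s hs
      have e : V p - P s (V p) = s * rho' (P s (V p)) := by linarith [hfoc s hs (V p)]
      have e2 : -(s * rho' (P s (V p))) ^ 2 / (2 * s ^ 2) = -(rho' (P s (V p)) ^ 2 / 2) := by
        field_simp
      have h1 := rho'_pos (P s (V p))
      have h2 := rho'_le_one (P s (V p))
      have h3 := rho'_pos (-(κ * p.1))
      have h4 := rho'_le_one (-(κ * p.1))
      rw [e, e2, Real.norm_eq_abs, abs_mul, abs_neg, abs_of_pos h3, abs_of_nonneg (by positivity)]
      have h5 : rho' (P s (V p)) ^ 2 / 2 ≤ 1 / 2 := by nlinarith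
      exact (mul_le_of_le_one_left (by positivity) h4).trans h5)
    (integrable_const _)
    (Filter.Eventually.of_forall fun p s hs =>
      (hMderiv (V p) s (hball s hs)).const_mul _)).2
  have hfin := (hint.const_mul 2).const_add (∫ p, rho' (κ * p.1) * V p ∂gauss2)
  refine HasDerivWithinAt.congr (HasDerivAt.hasDerivWithinAt ?_) (fun s hs => hFeq s hs)
    (hFeq γ hγ)
  convert hfin using 1
  rw [← integral_const_mul, ← integral_const_mul]
  congr 1
  ext p
  change -(1 / γ ^ 2) * (rho' (-(κ * p.1)) * (V p - P γ (V p)) ^ 2) = _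
  field_simp
end

section
/- Let κ, δ, σ, τ, r, λ > 0, θ ∈ ℝ, s ∈ (0, 1). Let Z be a standard normal random variable and let β be independent of Z with the sparse distribution Π: β = 0 with probability 1 − s, and conditional on being nonzero β is Gaussian with mean 0 and variance κ²/s. Then E[Z·η(στ(θβ + (r/√δ)Z), λστ)] = (2στr/√δ)·(s·Q(t₁) + (1 − s)·Q(t₂)), where t₁ = λ/√(r²/δ + θ²κ²/s), t₂ = λ√δ/r, η(x, t) = sign(x)·max(|x| − t, 0) is soft-thresholding, and Q is the Gaussian tail function. -/
open MeasureTheory ProbabilityTheory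

/-- The soft-thresholding function η(x, t) = sign(x)·max(|x| − t, 0). -/
noncomputable def softThresh (x t : ℝ) : ℝ := Real.sign x * max (|x| - t) 0

/-- The Gaussian tail function Q(t) = ∫_t^∞ e^{−x²/2}/√(2π) dx. -/
noncomputable def gaussQ (t : ℝ) : ℝ :=
  ∫ x in Set.Ioi t, Real.exp (-x ^ 2 / 2) / Real.sqrt (2 * Real.pi)

/-- The sparse prior Π = (1 − s)·δ₀ + s·N(0, κ²/s). -/
noncomputable def sparseDist (s κ : ℝ) : Measure ℝ :=
  ENNReal.ofReal (1 - s) • Measure.dirac (0 : ℝ) +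
    ENNReal.ofReal s • gaussianReal 0 ((κ ^ 2 / s).toNNReal)

lemma softThresh_eq_sub {t : ℝ} (ht : 0 ≤ t) (x : ℝ) :
    softThresh x t = max (x - t) 0 - max (-x - t) 0 := by
  unfold softThresh
  rcases lt_trichotomy x 0 with h | h | h
  · rw [Real.sign_of_neg h, abs_of_neg h, max_eq_right (by linarith : x - t ≤ 0)]
    ring
  · subst h
    simp
  · rw [Real.sign_of_pos h, abs_of_pos h, max_eq_right (by linarith : -x - t ≤ 0)]
    ring

lemma softThresh_mul {k : ℝ} (hk : 0 < k) {t : ℝ} (ht : 0 ≤ t) (x : ℝ) :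
    softThresh (k * x) (k * t) = k * softThresh x t := by
  rw [softThresh_eq_sub (by positivity), softThresh_eq_sub ht, mul_sub,
    mul_max_of_nonneg _ _ hk.le, mul_max_of_nonneg _ _ hk.le]
  ring_nf

lemma continuous_softThresh {t : ℝ} (ht : 0 ≤ t) : Continuous fun x ↦ softThresh x t := by
  simp_rw [softThresh_eq_sub ht]
  fun_prop

lemma abs_softThresh_le {t : ℝ} (ht : 0 ≤ t) (x : ℝ) : |softThresh x t| ≤ |x| := by
  rw [softThresh_eq_sub ht]
  grind

lemma gaussianPDFReal_standard (x : ℝ) :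
    gaussianPDFReal 0 1 x = Real.exp (-x ^ 2 / 2) / Real.sqrt (2 * Real.pi) := by
  simp [gaussianPDFReal, div_eq_inv_mul]

lemma hasDerivAt_gaussianPDFReal_standard (x : ℝ) :
    HasDerivAt (gaussianPDFReal 0 1) (-x * gaussianPDFReal 0 1 x) x := by
  have h : HasDerivAt (fun y : ℝ ↦ -y ^ 2 / 2) (-x) x := by
    refine ((hasDerivAt_pow 2 x).neg.div_const 2).congr_deriv ?_
    norm_num
    ring
  rw [funext gaussianPDFReal_standard]
  refine (h.exp.div_const (Real.sqrt (2 * Real.pi))).congr_deriv ?_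
  ring

lemma integrable_mul_gaussianPDFReal_iff {μ : ℝ} {v : NNReal} (hv : v ≠ 0) {f : ℝ → ℝ} :
    Integrable (fun x ↦ gaussianPDFReal μ v x * f x) ↔ Integrable f (gaussianReal μ v) := by
  rw [gaussianReal_of_var_ne_zero _ hv, integrable_withDensity_iff_integrable_smul'
    (measurable_gaussianPDF μ v) (ae_of_all _ fun _ ↦ gaussianPDF_lt_top)]
  simp [toReal_gaussianPDF]

lemma integrable_id_mul_id_sub_gaussianReal (m : ℝ) :
    Integrable (fun x ↦ x * (x - m)) (gaussianReal 0 1) :=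
  (memLp_id_gaussianReal' 2 (by simp)).integrable_mul
    ((memLp_id_gaussianReal' 2 (by simp)).sub (memLp_const m))

lemma setIntegral_Ioi_mul_sub_gaussianPDFReal (m : ℝ) :
    ∫ x in Set.Ioi m, gaussianPDFReal 0 1 x * (x * (x - m)) =
      ∫ x in Set.Ioi m, gaussianPDFReal 0 1 x := by
  have h₁ : Integrable fun x ↦ gaussianPDFReal 0 1 x * (x * (x - m)) :=
    (integrable_mul_gaussianPDFReal_iff one_ne_zero).2 (integrable_id_mul_id_sub_gaussianReal m)
  have h₂ : Integrable (gaussianPDFReal 0 1) := integrable_gaussianPDFReal 0 1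
  have h₃ : Integrable fun x ↦ gaussianPDFReal 0 1 x * (x - m) :=
    (integrable_mul_gaussianPDFReal_iff one_ne_zero).2
      (((memLp_id_gaussianReal' 1 (by simp)).sub (memLp_const m)).integrable le_rfl)
  have hderiv (x : ℝ) : HasDerivAt (fun x ↦ gaussianPDFReal 0 1 x * (x - m))
      (gaussianPDFReal 0 1 x - gaussianPDFReal 0 1 x * (x * (x - m))) x := by
    refine ((hasDerivAt_gaussianPDFReal_standard x).mul
      ((hasDerivAt_id x).sub_const m)).congr_deriv ?_
    simp only [id_eq]
    ring
  have h := integral_Ioi_of_hasDerivAt_of_tendsto' (a := m) (fun x _ ↦ hderiv x)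
    (h₂.sub h₁).integrableOn
    (tendsto_zero_of_hasDerivAt_of_integrableOn_Ioi (a := m) (fun x _ ↦ hderiv x)
      (h₂.sub h₁).integrableOn h₃.integrableOn)
  rw [integral_sub h₂.integrableOn h₁.integrableOn] at h
  simp only [sub_self, mul_zero] at h
  linarith

lemma gaussianReal_real_eq_integral (A : Set ℝ) :
    (gaussianReal 0 1).real A = ∫ x in A, gaussianPDFReal 0 1 x := by
  rw [measureReal_def, gaussianReal_apply_eq_integral _ one_ne_zero, ENNReal.toReal_ofReal]
  exact integral_nonneg fun _ ↦ gaussianPDFReal_nonneg _ _ _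

/-- Stein's identity for a positive part of an increasing affine function. -/
lemma integral_mul_max_gaussianReal {b : ℝ} (hb : 0 < b) (c : ℝ) :
    ∫ z, z * max (c + b * z) 0 ∂gaussianReal 0 1 =
      b * (gaussianReal 0 1).real {z | 0 < c + b * z} := by
  have hset : {z | 0 < c + b * z} = Set.Ioi (-c / b) := by
    ext z
    simp only [Set.mem_ofPred_eq, Set.mem_Ioi, div_lt_iff₀ hb]
    constructor <;> intro h <;> linarith
  rw [hset, gaussianReal_real_eq_integral, ← setIntegral_Ioi_mul_sub_gaussianPDFReal,
    integral_gaussianReal_eq_integral_smul one_ne_zero, ← integral_const_mul,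
    ← integral_indicator measurableSet_Ioi]
  congr 1 with z
  have hz : c + b * z = b * (z - -c / b) := by field_simp; ring
  by_cases h : z ∈ Set.Ioi (-c / b)
  · rw [Set.indicator_of_mem h, hz, max_eq_left]
    · simp only [smul_eq_mul]; ring
    · exact mul_nonneg hb.le (sub_nonneg.2 (le_of_lt h))
  · rw [Set.indicator_of_notMem h, hz, max_eq_right]
    · simp
    · exact mul_nonpos_of_nonneg_of_nonpos hb.le (sub_nonpos.2 (not_lt.1 h))

lemma integral_comp_neg_gaussianReal (v : NNReal) (f : ℝ → ℝ) :
    ∫ z, f (-z) ∂gaussianReal 0 v = ∫ z, f z ∂gaussianReal 0 v := by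
  have h := (MeasurableEquiv.neg ℝ).measurableEmbedding.integral_map
    (μ := gaussianReal 0 v) f
  have hm : (gaussianReal 0 v).map (MeasurableEquiv.neg ℝ) = gaussianReal 0 v := by
    simpa using gaussianReal_map_neg (μ := 0) (v := v)
  rw [hm] at h
  exact h.symm

lemma integrable_mul_max_gaussianReal (b c : ℝ) :
    Integrable (fun z ↦ z * max (c + b * z) 0) (gaussianReal 0 1) := by
  have hid : MemLp (fun z : ℝ ↦ z) 2 (gaussianReal 0 1) := memLp_id_gaussianReal' 2 (by simp)
  have h : MemLp (fun z ↦ c + b * z) 2 (gaussianReal 0 1) := (memLp_const c).add (hid.const_mul b)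
  exact hid.integrable_mul (h.sup (memLp_const 0))

lemma integral_mul_softThresh_gaussianReal {b : ℝ} (hb : 0 < b) {t : ℝ} (ht : 0 ≤ t) (c : ℝ) :
    ∫ z, z * softThresh (c + b * z) t ∂gaussianReal 0 1 =
      b * ((gaussianReal 0 1).real {z | t < c + b * z} +
        (gaussianReal 0 1).real {z | t < -c + b * z}) := by
  have h (z : ℝ) : z * softThresh (c + b * z) t =
      z * max ((c - t) + b * z) 0 - z * max ((-c - t) + (-b) * z) 0 := by
    rw [softThresh_eq_sub ht]
    ring_nf
  have hneg : ∫ z, z * max ((-c - t) + (-b) * z) 0 ∂gaussianReal 0 1 =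
      -∫ z, z * max ((-c - t) + b * z) 0 ∂gaussianReal 0 1 := by
    rw [← integral_comp_neg_gaussianReal, ← integral_neg]
    congr 1 with z
    ring_nf
  simp_rw [h]
  rw [integral_sub (integrable_mul_max_gaussianReal _ _) (integrable_mul_max_gaussianReal _ _),
    hneg, integral_mul_max_gaussianReal hb, integral_mul_max_gaussianReal hb]
  have e (d : ℝ) : {z | 0 < (d - t) + b * z} = {z | t < d + b * z} := by
    ext z
    simp only [Set.mem_ofPred_eq]
    constructor <;> intro h <;> linarith
  rw [e, e]
  ring

lemma map_affine_prod_gaussianReal (a b : ℝ) (v : NNReal) :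
    ((gaussianReal 0 v).prod (gaussianReal 0 1)).map (fun p ↦ a * p.1 + b * p.2) =
      gaussianReal 0 (a ^ 2 * v + b ^ 2).toNNReal := by
  have h : (fun p : ℝ × ℝ ↦ a * p.1 + b * p.2) =
      (fun p ↦ p.1 + p.2) ∘ Prod.map (a * ·) (b * ·) := rfl
  rw [h, ← Measure.map_map (by fun_prop) (by fun_prop),
    ← Measure.map_prod_map _ _ (by fun_prop) (by fun_prop), gaussianReal_map_const_mul,
    gaussianReal_map_const_mul]
  change gaussianReal (a * 0) _ ∗ gaussianReal (b * 0) _ = _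
  rw [gaussianReal_conv_gaussianReal]
  congr 1
  · simp
  · ext
    rw [Real.coe_toNNReal _ (by positivity)]
    simp

lemma gaussianReal_real_Ioi {v : ℝ} (hv : 0 < v) (t : ℝ) :
    (gaussianReal 0 v.toNNReal).real (Set.Ioi t) = gaussQ (t / Real.sqrt v) := by
  have hmap : gaussianReal 0 v.toNNReal = (gaussianReal 0 1).map (Real.sqrt v * ·) := by
    rw [gaussianReal_map_const_mul]
    congr 1
    · simp
    · ext
      simp [Real.sq_sqrt hv.le, hv.le]
  have hset : (Real.sqrt v * ·) ⁻¹' Set.Ioi t = Set.Ioi (t / Real.sqrt v) := by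
    ext x
    simp [div_lt_iff₀' (Real.sqrt_pos.2 hv)]
  rw [hmap, map_measureReal_apply (by fun_prop) measurableSet_Ioi, hset,
    gaussianReal_real_eq_integral, gaussQ]
  simp_rw [gaussianPDFReal_standard]

lemma measurableSet_lt_affine (a b t : ℝ) : MeasurableSet {p : ℝ × ℝ | t < a * p.1 + b * p.2} :=
  measurableSet_lt (by fun_prop) (by fun_prop)

lemma integrable_gaussianReal_real_lt_affine (a b t : ℝ) (ν : Measure ℝ) [IsFiniteMeasure ν] :
    Integrable (fun x ↦ (gaussianReal 0 1).real {z | t < a * x + b * z}) ν := by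
  refine Integrable.of_bound (C := 1) ?_ (ae_of_all _ fun x ↦ ?_)
  · exact (measurable_measure_prodMk_left
      (measurableSet_lt_affine a b t)).ennreal_toReal.aestronglyMeasurable
  · rw [Real.norm_of_nonneg measureReal_nonneg]
    exact measureReal_le_one

lemma integral_gaussianReal_real_lt_affine (a : ℝ) {b : ℝ} (hb : 0 < b) (t : ℝ) (v : NNReal) :
    ∫ x, (gaussianReal 0 1).real {z | t < a * x + b * z} ∂gaussianReal 0 v =
      gaussQ (t / Real.sqrt (a ^ 2 * v + b ^ 2)) := by
  rw [← gaussianReal_real_Ioi (by positivity), ← map_affine_prod_gaussianReal,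
    map_measureReal_apply (by fun_prop) measurableSet_Ioi, measureReal_def,
    Measure.prod_apply (measurableSet_Ioi.preimage (by fun_prop))]
  exact integral_toReal
    (measurable_measure_prodMk_left (measurableSet_lt_affine a b t)).aemeasurable
    (ae_of_all _ fun _ ↦ measure_lt_top _ _)

lemma integrable_mul_softThresh_prod_gaussianReal (a b : ℝ) {t : ℝ} (ht : 0 ≤ t) (v : NNReal) :
    Integrable (fun p : ℝ × ℝ ↦ p.2 * softThresh (a * p.1 + b * p.2) t)
      ((gaussianReal 0 v).prod (gaussianReal 0 1)) := by
  have h₁ : MemLp (fun p : ℝ × ℝ ↦ p.1) 2 ((gaussianReal 0 v).prod (gaussianReal 0 1)) :=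
    (memLp_id_gaussianReal' 2 (by simp)).comp_fst _
  have h₂ : MemLp (fun p : ℝ × ℝ ↦ p.2) 2 ((gaussianReal 0 v).prod (gaussianReal 0 1)) :=
    (memLp_id_gaussianReal' 2 (by simp)).comp_snd _
  have hsum : MemLp (fun p : ℝ × ℝ ↦ a * p.1 + b * p.2) 2
      ((gaussianReal 0 v).prod (gaussianReal 0 1)) := (h₁.const_mul a).add (h₂.const_mul b)
  refine h₂.integrable_mul (hsum.mono ?_ (ae_of_all _ fun p ↦ abs_softThresh_le ht _))
  exact ((continuous_softThresh ht).comp (by fun_prop)).aestronglyMeasurable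

lemma integral_mul_softThresh_prod_gaussianReal (a : ℝ) {b : ℝ} (hb : 0 < b) {t : ℝ} (ht : 0 ≤ t)
    (v : NNReal) :
    ∫ p : ℝ × ℝ, p.2 * softThresh (a * p.1 + b * p.2) t
        ∂((gaussianReal 0 v).prod (gaussianReal 0 1)) =
      2 * b * gaussQ (t / Real.sqrt (a ^ 2 * v + b ^ 2)) := by
  rw [integral_prod _ (integrable_mul_softThresh_prod_gaussianReal a b ht v)]
  simp_rw [integral_mul_softThresh_gaussianReal hb ht, ← neg_mul]
  rw [integral_const_mul, integral_add (integrable_gaussianReal_real_lt_affine a b t _)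
    (integrable_gaussianReal_real_lt_affine (-a) b t _),
    integral_gaussianReal_real_lt_affine _ hb, integral_gaussianReal_real_lt_affine _ hb, neg_sq]
  ring


/-- With β ∼ Π (sparse prior) independent of Z standard normal:
E[Z·η(στ(θβ + (r/√δ)Z), λστ)] = (2στr/√δ)·(s·Q(t₁) + (1 − s)·Q(t₂)),
where t₁ = λ/√(r²/δ + θ²κ²/s) and t₂ = λ√δ/r. -/
theorem stmt16 (κ δ σ τ r lam θ s : ℝ)
    (hκ : 0 < κ) (hδ : 0 < δ) (hσ : 0 < σ) (hτ : 0 < τ) (hr : 0 < r) (hlam : 0 < lam)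
    (hs0 : 0 < s) (hs1 : s < 1) :
    ∫ p : ℝ × ℝ,
        p.2 * softThresh (σ * τ * (θ * p.1 + (r / Real.sqrt δ) * p.2)) (lam * σ * τ)
        ∂((sparseDist s κ).prod (gaussianReal 0 1))
      = (2 * σ * τ * r / Real.sqrt δ) *
          (s * gaussQ (lam / Real.sqrt (r ^ 2 / δ + θ ^ 2 * κ ^ 2 / s)) +
            (1 - s) * gaussQ (lam * Real.sqrt δ / r)) := by
  set b := r / Real.sqrt δ with hb_def
  have hb : 0 < b := by positivity
  have hk : 0 < σ * τ := by positivity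
  have hscale (p : ℝ × ℝ) :
      p.2 * softThresh (σ * τ * (θ * p.1 + b * p.2)) (lam * σ * τ) =
        σ * τ * (p.2 * softThresh (θ * p.1 + b * p.2) lam) := by
    rw [show lam * σ * τ = σ * τ * lam by ring, softThresh_mul hk hlam.le]
    ring
  simp_rw [hscale]
  rw [integral_const_mul, sparseDist, ← gaussianReal_zero_var, Measure.add_prod,
    Measure.prod_smul_left, Measure.prod_smul_left,
    integral_add_measure
      ((integrable_mul_softThresh_prod_gaussianReal θ b hlam.le _).smul_measure
        ENNReal.ofReal_ne_top)
      ((integrable_mul_softThresh_prod_gaussianReal θ b hlam.le _).smul_measure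
        ENNReal.ofReal_ne_top),
    integral_smul_measure, integral_smul_measure,
    integral_mul_softThresh_prod_gaussianReal θ hb hlam.le,
    integral_mul_softThresh_prod_gaussianReal θ hb hlam.le,
    ENNReal.toReal_ofReal hs0.le, ENNReal.toReal_ofReal (by linarith),
    Real.coe_toNNReal _ (by positivity)]
  have h₁ : lam / Real.sqrt (θ ^ 2 * (0 : NNReal) + b ^ 2) = lam * Real.sqrt δ / r := by
    rw [NNReal.coe_zero, mul_zero, zero_add, Real.sqrt_sq hb.le, hb_def]
    field_simp
  have h₂ : θ ^ 2 * (κ ^ 2 / s) + b ^ 2 = r ^ 2 / δ + θ ^ 2 * κ ^ 2 / s := by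
    rw [hb_def, div_pow, Real.sq_sqrt hδ.le]
    ring
  rw [h₁, h₂, show 2 * σ * τ * r / Real.sqrt δ = 2 * σ * τ * b by rw [hb_def]; ring]
  simp only [smul_eq_mul]
  ring
end
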